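/- arXiv:1411.3142 — 2 statements merged into one kernel-verified Lean document; each statement's English description precedes it below -/
import Mathlib

section
/- The Bethe-ansatz function Q is smooth in (y,t) and satisfies the backward heat equation ∂_t Q_y(x,t) = (1/2) Σ_{i=1}^N ∂²Q_y(x,t)/∂y_i² for all x, y ∈ ℝ^N and all t > 0. -/
open MeasureTheory Filter Set

/-- The point on the vertical contour `Γ_a` at height `φ`. -/
noncomputable def lineZ (a φ : ℝ) : ℂ := (a : ℂ) + φ * Complex.I

/-- The ratio of scattering amplitudes `S(z_α, z_β) = −(τ z_α − z_β)/(τ z_β − z_α)`. -/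
noncomputable def Sfac (τ : ℝ) (zα zβ : ℂ) : ℂ := -(((τ : ℂ) * zα - zβ) / ((τ : ℂ) * zβ - zα))

/-- The Bethe-ansatz amplitude `A_σ(z) = ∏_{(α,β) ∈ In(σ)} S(z_α, z_β)`, the product being
over the inversions of `σ`, i.e. over pairs `(σ(i), σ(j))` with `i < j` and `σ(i) > σ(j)`. -/
noncomputable def Aamp (N : ℕ) (τ : ℝ) (σ : Equiv.Perm (Fin N)) (z : Fin N → ℂ) : ℂ :=
  ∏ pr ∈ Finset.univ.filter (fun pr : Fin N × Fin N => pr.1 < pr.2 ∧ σ pr.2 < σ pr.1),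
    Sfac τ (z (σ pr.1)) (z (σ pr.2))

/-- The single-permutation contour integral
`I_σ(y;x,t) = ∫_{Γ_a} dz₁ ⋯ ∫_{Γ_a} dz_N A_σ(z) ∏_j e^{z_{σ(j)}(x_j − y_{σ(j)})} e^{z_j² t/2}`,
each contour integral carrying the conventional prefactor `1/(2πi)`. -/
noncomputable def Iperm (N : ℕ) (τ a : ℝ) (σ : Equiv.Perm (Fin N))
    (y x : Fin N → ℝ) (t : ℝ) : ℂ :=
  (1 / (2 * Real.pi)) ^ N *
    ∫ φ : Fin N → ℝ,
      Aamp N τ σ (fun j => lineZ a (φ j)) *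
        ∏ j : Fin N,
          Complex.exp (lineZ a (φ (σ j)) * ((x j : ℂ) - (y (σ j) : ℂ))) *
            Complex.exp (lineZ a (φ j) ^ 2 * (t : ℂ) / 2)

/-- The Bethe-ansatz function `Q_y(x,t) = Σ_{σ ∈ S_N} I_σ(y;x,t)`. -/
noncomputable def Qfun (N : ℕ) (τ a : ℝ) (y x : Fin N → ℝ) (t : ℝ) : ℂ :=
  ∑ σ : Equiv.Perm (Fin N), Iperm N τ a σ y x t

section

variable {N : ℕ} {V : Type} [NormedAddCommGroup V]

/-- Continuous functions growing more slowly than every Gaussian `exp (δ ‖φ‖²)`, `δ > 0`. -/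
def SubGaussianGrowth (c : (Fin N → ℝ) → V) : Prop :=
  Continuous c ∧ ∀ δ : ℝ, 0 < δ → ∃ C : ℝ, ∀ φ, ‖c φ‖ ≤ C * Real.exp (δ * ∑ j, φ j ^ 2)

namespace SubGaussianGrowth

theorem of_bounded {c : (Fin N → ℝ) → V} (hc : Continuous c) {C : ℝ} (h : ∀ φ, ‖c φ‖ ≤ C) :
    SubGaussianGrowth c := by
  refine ⟨hc, fun δ hδ => ⟨C, fun φ => (h φ).trans ?_⟩⟩
  have hC : 0 ≤ C := (norm_nonneg _).trans (h φ)
  refine le_mul_of_one_le_right hC (Real.one_le_exp ?_)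
  exact mul_nonneg hδ.le (Finset.sum_nonneg fun j _ => sq_nonneg _)

theorem const (v : V) : SubGaussianGrowth (fun _ : Fin N → ℝ => v) :=
  of_bounded continuous_const fun _ => le_rfl

theorem of_norm_le_mul {W X : Type} [NormedAddCommGroup W] [NormedAddCommGroup X]
    {f : (Fin N → ℝ) → V} {g : (Fin N → ℝ) → W} {h : (Fin N → ℝ) → X}
    (hf : SubGaussianGrowth f) (hg : SubGaussianGrowth g) (hh : Continuous h)
    (hle : ∀ φ, ‖h φ‖ ≤ ‖f φ‖ * ‖g φ‖) : SubGaussianGrowth h := by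
  refine ⟨hh, fun δ hδ => ?_⟩
  obtain ⟨C, hC⟩ := hf.2 (δ / 2) (half_pos hδ)
  obtain ⟨D, hD⟩ := hg.2 (δ / 2) (half_pos hδ)
  refine ⟨C * D, fun φ => (hle φ).trans ?_⟩
  calc ‖f φ‖ * ‖g φ‖
      ≤ (C * Real.exp (δ / 2 * ∑ j, φ j ^ 2)) * (D * Real.exp (δ / 2 * ∑ j, φ j ^ 2)) :=
        mul_le_mul (hC φ) (hD φ) (norm_nonneg _) ((norm_nonneg _).trans (hC φ))
    _ = C * D * (Real.exp (δ / 2 * ∑ j, φ j ^ 2) * Real.exp (δ / 2 * ∑ j, φ j ^ 2)) := by ring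
    _ = C * D * Real.exp (δ * ∑ j, φ j ^ 2) := by
        rw [← Real.exp_add]; congr 2; ring

theorem smul [NormedSpace ℂ V] {f : (Fin N → ℝ) → ℂ} {g : (Fin N → ℝ) → V}
    (hf : SubGaussianGrowth f) (hg : SubGaussianGrowth g) :
    SubGaussianGrowth (fun φ => f φ • g φ) :=
  of_norm_le_mul hf hg (hf.1.smul hg.1) fun _ => (norm_smul _ _).le

theorem mul {f g : (Fin N → ℝ) → ℂ} (hf : SubGaussianGrowth f) (hg : SubGaussianGrowth g) :
    SubGaussianGrowth (fun φ => f φ * g φ) :=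
  hf.smul hg

theorem add {f g : (Fin N → ℝ) → V} (hf : SubGaussianGrowth f) (hg : SubGaussianGrowth g) :
    SubGaussianGrowth (fun φ => f φ + g φ) := by
  refine ⟨hf.1.add hg.1, fun δ hδ => ?_⟩
  obtain ⟨C, hC⟩ := hf.2 δ hδ
  obtain ⟨D, hD⟩ := hg.2 δ hδ
  refine ⟨C + D, fun φ => (norm_add_le _ _).trans ?_⟩
  rw [add_mul]
  exact add_le_add (hC φ) (hD φ)

theorem neg {f : (Fin N → ℝ) → V} (hf : SubGaussianGrowth f) :
    SubGaussianGrowth (fun φ => -f φ) :=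
  ⟨hf.1.neg, by simpa only [norm_neg] using hf.2⟩

theorem sum {ι : Type*} (s : Finset ι) {f : ι → (Fin N → ℝ) → V}
    (hf : ∀ i ∈ s, SubGaussianGrowth (f i)) :
    SubGaussianGrowth (fun φ => ∑ i ∈ s, f i φ) := by
  classical
  induction s using Finset.induction_on with
  | empty => simpa using const (0 : V)
  | insert i s hi ih =>
    simp only [Finset.sum_insert hi]
    exact (hf i (Finset.mem_insert_self i s)).add
      (ih fun k hk => hf k (Finset.mem_insert_of_mem hk))

theorem prod {ι : Type*} (s : Finset ι) {f : ι → (Fin N → ℝ) → ℂ}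
    (hf : ∀ i ∈ s, SubGaussianGrowth (f i)) :
    SubGaussianGrowth (fun φ => ∏ i ∈ s, f i φ) := by
  classical
  induction s using Finset.induction_on with
  | empty => simpa using const (1 : ℂ)
  | insert i s hi ih =>
    simp only [Finset.prod_insert hi]
    exact (hf i (Finset.mem_insert_self i s)).mul
      (ih fun k hk => hf k (Finset.mem_insert_of_mem hk))

theorem coord (j : Fin N) : SubGaussianGrowth (fun φ : Fin N → ℝ => (φ j : ℂ)) := by
  refine ⟨by fun_prop, fun δ hδ => ⟨1 + 1 / δ, fun φ => ?_⟩⟩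
  have hj : φ j ^ 2 ≤ ∑ k, φ k ^ 2 :=
    Finset.single_le_sum (f := fun k => φ k ^ 2) (fun k _ => sq_nonneg _) (Finset.mem_univ j)
  set s := ∑ k, φ k ^ 2
  have hs : 0 ≤ s := (sq_nonneg _).trans hj
  have h1 : 1 ≤ Real.exp (δ * s) := Real.one_le_exp (mul_nonneg hδ.le hs)
  have h2 : s ≤ 1 / δ * Real.exp (δ * s) := by
    rw [one_div, ← div_eq_inv_mul, le_div_iff₀ hδ]
    linarith [Real.add_one_le_exp (δ * s)]
  have h3 : |φ j| ≤ 1 + φ j ^ 2 := by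
    rw [← sq_abs]; nlinarith [sq_nonneg (|φ j| - 1), sq_nonneg (|φ j|)]
  rw [Complex.norm_real, Real.norm_eq_abs, add_mul, one_mul]
  linarith

theorem lineZ_coord (a : ℝ) (j : Fin N) :
    SubGaussianGrowth (fun φ : Fin N → ℝ => lineZ a (φ j)) :=
  (const (a : ℂ)).add ((coord j).mul (const Complex.I))

end SubGaussianGrowth

theorem lineZ_re (a s : ℝ) : (lineZ a s).re = a := by simp [lineZ]

theorem lineZ_sq_re (a s : ℝ) : (lineZ a s ^ 2).re = a ^ 2 - s ^ 2 := by
  simp [lineZ, sq]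

/-- The exponent `-∑ z_j y_j + (∑ z_j²) t / 2` as a real-linear function of `(y, t)`. -/
noncomputable def heatExponent (a : ℝ) (φ : Fin N → ℝ) : ((Fin N → ℝ) × ℝ) →L[ℝ] ℂ :=
  (∑ j, (-lineZ a (φ j)) • (Complex.ofRealCLM ∘L ContinuousLinearMap.proj j ∘L
      ContinuousLinearMap.fst ℝ (Fin N → ℝ) ℝ)) +
    (∑ j, lineZ a (φ j) * lineZ a (φ j) * (1 / 2)) •
      (Complex.ofRealCLM ∘L ContinuousLinearMap.snd ℝ (Fin N → ℝ) ℝ)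

theorem heatExponent_apply (a : ℝ) (φ y : Fin N → ℝ) (t : ℝ) :
    heatExponent a φ (y, t) =
      ∑ j, -lineZ a (φ j) * y j + (∑ j, lineZ a (φ j) * lineZ a (φ j) * (1 / 2)) * t := by
  simp [heatExponent]

theorem SubGaussianGrowth.heatExponent (a : ℝ) :
    SubGaussianGrowth (fun φ : Fin N → ℝ => heatExponent a φ) :=
  (SubGaussianGrowth.sum _ fun j _ => (lineZ_coord a j).neg.smul (const _)).add
    ((SubGaussianGrowth.sum _ fun j _ =>
      ((lineZ_coord a j).mul (lineZ_coord a j)).mul (const _)).smul (const _))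

theorem SubGaussianGrowth.heatExponent_apply (a : ℝ) (p : (Fin N → ℝ) × ℝ) :
    SubGaussianGrowth (fun φ : Fin N → ℝ => _root_.heatExponent a φ p) :=
  (SubGaussianGrowth.heatExponent a).of_norm_le_mul (const (‖p‖ : ℂ))
    ((SubGaussianGrowth.heatExponent a).1.clm_apply continuous_const)
    fun φ => by simpa using (_root_.heatExponent a φ).le_opNorm p

theorem SubGaussianGrowth.heatExponent_smulRight [NormedSpace ℂ V] (a : ℝ) {c : (Fin N → ℝ) → V}
    (hc : SubGaussianGrowth c) :
    SubGaussianGrowth (fun φ => (_root_.heatExponent a φ).smulRight (c φ)) := by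
  refine (SubGaussianGrowth.heatExponent a).of_norm_le_mul hc ?_ fun φ => ?_
  · exact (((ContinuousLinearMap.lsmul ℝ ℂ).flip.continuous.comp hc.1).clm_comp
      (SubGaussianGrowth.heatExponent a).1 :
        Continuous fun φ => ((ContinuousLinearMap.lsmul ℝ ℂ).flip (c φ)).comp
          (_root_.heatExponent a φ))
  · refine ContinuousLinearMap.opNorm_le_bound _ (by positivity) fun p => ?_
    rw [ContinuousLinearMap.smulRight_apply, norm_smul, mul_right_comm]
    exact mul_le_mul_of_nonneg_right ((_root_.heatExponent a φ).le_opNorm p) (norm_nonneg _)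

theorem norm_exp_heatExponent (a : ℝ) (φ y : Fin N → ℝ) (t : ℝ) :
    ‖Complex.exp (heatExponent a φ (y, t))‖ =
      Real.exp (-a * ∑ j, y j + N * a ^ 2 * t / 2) * Real.exp (-(t / 2) * ∑ j, φ j ^ 2) := by
  rw [Complex.norm_exp, ← Real.exp_add, heatExponent_apply]
  congr 1
  have h : ∀ j, (lineZ a (φ j) * lineZ a (φ j) * (1 / 2)).re = (a ^ 2 - φ j ^ 2) / 2 := by
    intro j
    rw [← sq, ← lineZ_sq_re]
    simp [div_eq_mul_inv]
  simp only [Complex.add_re, Complex.re_sum, Complex.mul_re, Complex.ofReal_re, Complex.ofReal_im,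
    mul_zero, sub_zero, Complex.neg_re, lineZ_re] at h ⊢
  simp only [h, ← Finset.sum_div, Finset.sum_sub_distrib, ← Finset.mul_sum, Finset.sum_const,
    Finset.card_univ, Fintype.card_fin, nsmul_eq_mul]
  ring

theorem exists_norm_exp_heatExponent_le (a : ℝ) (p : (Fin N → ℝ) × ℝ) :
    ∃ K : ℝ, 0 ≤ K ∧ ∀ q ∈ Metric.ball p (p.2 / 2), ∀ φ : Fin N → ℝ,
      ‖Complex.exp (heatExponent a φ q)‖ ≤ K * Real.exp (-(p.2 / 4) * ∑ j, φ j ^ 2) := by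
  have hcont : Continuous fun q : (Fin N → ℝ) × ℝ =>
      Real.exp (-a * ∑ j, q.1 j + N * a ^ 2 * q.2 / 2) := by fun_prop
  obtain ⟨K, hK⟩ := (isCompact_closedBall p (p.2 / 2)).exists_bound_of_continuousOn
    hcont.continuousOn
  refine ⟨max K 0, le_max_right _ _, fun q hq φ => ?_⟩
  have h2 : p.2 / 2 < q.2 := by
    have h := (norm_snd_le (q - p)).trans_lt (mem_ball_iff_norm.1 hq)
    rw [Prod.snd_sub, Real.norm_eq_abs] at h
    linarith [(abs_lt.1 h).1]
  rw [show q = (q.1, q.2) from rfl, norm_exp_heatExponent]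
  have hs : 0 ≤ ∑ j, φ j ^ 2 := Finset.sum_nonneg fun j _ => sq_nonneg _
  refine mul_le_mul ?_ (Real.exp_le_exp.2 (by nlinarith)) (Real.exp_pos _).le (le_max_right _ _)
  exact (Real.le_norm_self _).trans ((hK q (Metric.ball_subset_closedBall hq)).trans
    (le_max_left _ _))

theorem integrable_exp_neg_mul_sum_sq {b : ℝ} (hb : 0 < b) :
    Integrable (fun φ : Fin N → ℝ => Real.exp (-b * ∑ j, φ j ^ 2)) := by
  have h : Integrable (fun φ : Fin N → ℝ => ∏ j, Real.exp (-b * φ j ^ 2)) :=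
    Integrable.fintype_prod (f := fun _ : Fin N => fun s : ℝ => Real.exp (-b * s ^ 2))
      fun _ => integrable_exp_neg_mul_sq hb
  simpa only [← Real.exp_sum, ← Finset.mul_sum] using h

theorem continuous_exp_heatExponent (a : ℝ) (p : (Fin N → ℝ) × ℝ) :
    Continuous fun φ : Fin N → ℝ => Complex.exp (heatExponent a φ p) :=
  Complex.continuous_exp.comp (SubGaussianGrowth.heatExponent_apply a p).1

namespace SubGaussianGrowth

variable [NormedSpace ℂ V]

theorem exists_integrable_bound (a : ℝ) {c : (Fin N → ℝ) → V} (hc : SubGaussianGrowth c)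
    {p : (Fin N → ℝ) × ℝ} (hp : 0 < p.2) :
    ∃ g : (Fin N → ℝ) → ℝ, Integrable g ∧ ∀ q ∈ Metric.ball p (p.2 / 2), ∀ φ,
      ‖Complex.exp (_root_.heatExponent a φ q) • c φ‖ ≤ g φ := by
  obtain ⟨K, hK0, hK⟩ := exists_norm_exp_heatExponent_le a p
  obtain ⟨C, hC⟩ := hc.2 (p.2 / 8) (by positivity)
  refine ⟨fun φ => K * C * Real.exp (-(p.2 / 8) * ∑ j, φ j ^ 2),
    (integrable_exp_neg_mul_sum_sq (by positivity)).const_mul _, fun q hq φ => ?_⟩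
  rw [norm_smul]
  calc _ ≤ (K * Real.exp (-(p.2 / 4) * ∑ j, φ j ^ 2)) *
        (C * Real.exp (p.2 / 8 * ∑ j, φ j ^ 2)) :=
        mul_le_mul (hK q hq φ) (hC φ) (norm_nonneg _) (by positivity)
    _ = K * C * (Real.exp (-(p.2 / 4) * ∑ j, φ j ^ 2) * Real.exp (p.2 / 8 * ∑ j, φ j ^ 2)) := by
        ring
    _ = _ := by rw [← Real.exp_add]; congr 2; ring

theorem integrable_exp_smul (a : ℝ) {c : (Fin N → ℝ) → V} (hc : SubGaussianGrowth c)
    {p : (Fin N → ℝ) × ℝ} (hp : 0 < p.2) :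
    Integrable fun φ => Complex.exp (_root_.heatExponent a φ p) • c φ := by
  obtain ⟨g, hg, hle⟩ := hc.exists_integrable_bound a hp
  exact hg.mono' ((continuous_exp_heatExponent a p).smul hc.1).aestronglyMeasurable
    (.of_forall (hle p (Metric.mem_ball_self (half_pos hp))))

theorem hasFDerivAt_integral (a : ℝ) {c : (Fin N → ℝ) → V} (hc : SubGaussianGrowth c)
    {p : (Fin N → ℝ) × ℝ} (hp : 0 < p.2) :
    HasFDerivAt (fun q => ∫ φ, Complex.exp (_root_.heatExponent a φ q) • c φ)
      (∫ φ, Complex.exp (_root_.heatExponent a φ p) •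
        (_root_.heatExponent a φ).smulRight (c φ)) p := by
  have hd := hc.heatExponent_smulRight a
  obtain ⟨g, hg, hle⟩ := hd.exists_integrable_bound a hp
  refine hasFDerivAt_integral_of_dominated_of_fderiv_le (bound := g)
    (F' := fun q φ => Complex.exp (_root_.heatExponent a φ q) •
      (_root_.heatExponent a φ).smulRight (c φ))
    (Metric.ball_mem_nhds p (half_pos hp))
    (.of_forall fun q => ((continuous_exp_heatExponent a q).smul hc.1).aestronglyMeasurable)
    (hc.integrable_exp_smul a hp)
    ((continuous_exp_heatExponent a p).smul hd.1).aestronglyMeasurable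
    (.of_forall fun φ q hq => hle q hq φ) hg (.of_forall fun φ q _ => ?_)
  have h := ((_root_.heatExponent a φ).hasFDerivAt (x := q)).cexp.smul_const (c φ)
  convert h using 1
  ext <;> simp [mul_smul]

theorem contDiffOn_integral (a : ℝ) (n : ℕ) :
    ∀ {V : Type} [NormedAddCommGroup V] [NormedSpace ℂ V] {c : (Fin N → ℝ) → V},
      SubGaussianGrowth c →
      ContDiffOn ℝ n (fun q => ∫ φ, Complex.exp (_root_.heatExponent a φ q) • c φ)
        (Set.univ ×ˢ Set.Ioi (0 : ℝ)) := by
  induction n with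
  | zero =>
    intro V _ _ c hc
    exact contDiffOn_zero.2 fun p hp =>
      (hc.hasFDerivAt_integral a hp.2).continuousAt.continuousWithinAt
  | succ n ih =>
    intro V _ _ c hc
    have hopen : IsOpen ((Set.univ : Set (Fin N → ℝ)) ×ˢ Set.Ioi (0 : ℝ)) :=
      isOpen_univ.prod isOpen_Ioi
    push_cast
    rw [contDiffOn_succ_iff_fderiv_of_isOpen hopen]
    refine ⟨fun p hp => (hc.hasFDerivAt_integral a hp.2).differentiableAt.differentiableWithinAt,
      by simp, ?_⟩
    exact (ih (hc.heatExponent_smulRight a)).congr fun p hp =>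
      (hc.hasFDerivAt_integral a hp.2).fderiv

theorem hasDerivAt_integral_comp (a : ℝ) {c : (Fin N → ℝ) → ℂ} (hc : SubGaussianGrowth c)
    {γ : ℝ → (Fin N → ℝ) × ℝ} {v : (Fin N → ℝ) × ℝ} {u : ℝ} (hγ : HasDerivAt γ v u)
    (hp : 0 < (γ u).2) :
    HasDerivAt (fun s => ∫ φ, Complex.exp (_root_.heatExponent a φ (γ s)) • c φ)
      (∫ φ, Complex.exp (_root_.heatExponent a φ (γ u)) •
        (_root_.heatExponent a φ v * c φ)) u := by
  have h := (hc.hasFDerivAt_integral a hp).comp_hasDerivAt u hγ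
  rw [ContinuousLinearMap.integral_apply
    ((hc.heatExponent_smulRight a).integrable_exp_smul a hp)] at h
  exact h

end SubGaussianGrowth

theorem SubGaussianGrowth.sfac {τ a : ℝ} (hτ : τ < 1) (ha : 0 < a) (i j : Fin N) :
    SubGaussianGrowth (fun φ : Fin N → ℝ => Sfac τ (lineZ a (φ i)) (lineZ a (φ j))) := by
  have hre : ∀ φ : Fin N → ℝ, ((τ : ℂ) * lineZ a (φ j) - lineZ a (φ i)).re = -((1 - τ) * a) := by
    intro φ
    simp only [Complex.sub_re, Complex.re_ofReal_mul, lineZ_re]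
    ring
  have hpos : 0 < (1 - τ) * a := mul_pos (sub_pos.2 hτ) ha
  have hden : ∀ φ : Fin N → ℝ, (1 - τ) * a ≤ ‖(τ : ℂ) * lineZ a (φ j) - lineZ a (φ i)‖ := by
    intro φ
    have h := Complex.abs_re_le_norm ((τ : ℂ) * lineZ a (φ j) - lineZ a (φ i))
    rwa [hre, abs_neg, abs_of_pos hpos] at h
  have hinv : SubGaussianGrowth
      (fun φ : Fin N → ℝ => ((τ : ℂ) * lineZ a (φ j) - lineZ a (φ i))⁻¹) := by
    refine of_bounded (C := ((1 - τ) * a)⁻¹) ?_ fun φ => ?_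
    · refine Continuous.inv₀ ?_ fun φ => norm_pos_iff.1 (hpos.trans_le (hden φ))
      exact (continuous_const.mul (lineZ_coord a j).1).sub (lineZ_coord a i).1
    · rw [norm_inv]
      exact inv_anti₀ hpos (hden φ)
  have h := ((((const (τ : ℂ)).mul (lineZ_coord a i)).add (lineZ_coord a j).neg).mul hinv).neg
  simpa only [Sfac, div_eq_mul_inv, sub_eq_add_neg] using h

/-- The part of the integrand of `Qfun` that does not depend on `(y, t)`. -/
noncomputable def heatAmplitude (τ a : ℝ) (x φ : Fin N → ℝ) : ℂ :=
  ∑ σ : Equiv.Perm (Fin N), (1 / (2 * Real.pi)) ^ N *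
    (Aamp N τ σ (fun j => lineZ a (φ j)) * ∏ j, Complex.exp (lineZ a (φ (σ j)) * x j))

theorem SubGaussianGrowth.heatAmplitude_term {τ a : ℝ} (hτ : τ < 1) (ha : 0 < a)
    (x : Fin N → ℝ) (σ : Equiv.Perm (Fin N)) :
    SubGaussianGrowth (fun φ : Fin N → ℝ => ((1 / (2 * Real.pi)) ^ N : ℂ) *
      (Aamp N τ σ (fun j => lineZ a (φ j)) *
        ∏ j, Complex.exp (lineZ a (φ (σ j)) * x j))) := by
  refine (const _).mul ((prod _ fun pr _ => sfac hτ ha _ _).mul (prod _ fun j _ => ?_))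
  refine of_bounded (C := Real.exp (a * x j)) ?_ fun φ => ?_
  · exact Complex.continuous_exp.comp ((lineZ_coord a (σ j)).1.mul continuous_const)
  · rw [Complex.norm_exp, Complex.re_mul_ofReal, lineZ_re]

theorem SubGaussianGrowth.heatAmplitude {τ a : ℝ} (hτ : τ < 1) (ha : 0 < a) (x : Fin N → ℝ) :
    SubGaussianGrowth (heatAmplitude τ a x) :=
  SubGaussianGrowth.sum _ fun σ _ => heatAmplitude_term hτ ha x σ

theorem prod_exp_eq_mul_exp_heatExponent (a : ℝ) (σ : Equiv.Perm (Fin N))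
    (x y φ : Fin N → ℝ) (t : ℝ) :
    (∏ j, Complex.exp (lineZ a (φ (σ j)) * ((x j : ℂ) - (y (σ j) : ℂ))) *
        Complex.exp (lineZ a (φ j) ^ 2 * (t : ℂ) / 2)) =
      Complex.exp (heatExponent a φ (y, t)) * ∏ j, Complex.exp (lineZ a (φ (σ j)) * x j) := by
  simp only [← Complex.exp_add, ← Complex.exp_sum]
  congr 1
  rw [heatExponent_apply, ← Equiv.sum_comp σ (fun j => -lineZ a (φ j) * (y j : ℂ)),
    Finset.sum_mul, ← Finset.sum_add_distrib, ← Finset.sum_add_distrib]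
  exact Finset.sum_congr rfl fun j _ => by ring

theorem Qfun_eq_integral {τ a : ℝ} (hτ : τ < 1) (ha : 0 < a) (x y : Fin N → ℝ) {t : ℝ}
    (ht : 0 < t) :
    Qfun N τ a y x t =
      ∫ φ, Complex.exp (heatExponent a φ (y, t)) • heatAmplitude τ a x φ := by
  simp only [heatAmplitude, Finset.smul_sum]
  rw [integral_finsetSum _ fun σ _ =>
    (SubGaussianGrowth.heatAmplitude_term hτ ha x σ).integrable_exp_smul a (p := (y, t)) ht]
  refine Finset.sum_congr rfl fun σ _ => ?_
  rw [Iperm, ← integral_const_mul]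
  congr 1 with φ
  rw [prod_exp_eq_mul_exp_heatExponent, smul_eq_mul]
  ring

end

/-- `Q_y(x,t)` is smooth in `(y,t)` and satisfies the backward heat equation
`∂_t Q = (1/2) Σ_i ∂²Q/∂y_i²` for all `x, y ∈ ℝ^N` and `t > 0`. -/
theorem Qfun_smooth_and_heat (N : ℕ) (hN : 1 ≤ N) (τ : ℝ) (hτ : τ ∈ Set.Ioo (0 : ℝ) 1)
    (a : ℝ) (ha : 0 < a) :
    (∀ x : Fin N → ℝ,
      ContDiffOn ℝ (⊤ : ℕ∞) (fun p : (Fin N → ℝ) × ℝ => Qfun N τ a p.1 x p.2)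
        (Set.univ ×ˢ Set.Ioi (0 : ℝ))) ∧
    ∀ (x y : Fin N → ℝ) (t : ℝ), 0 < t →
      deriv (fun s : ℝ => Qfun N τ a y x s) t =
        (1 / 2 : ℂ) * ∑ i : Fin N,
          deriv (fun u : ℝ =>
            deriv (fun v : ℝ => Qfun N τ a (Function.update y i v) x t) u) (y i) := by
  constructor
  · intro x
    have hc := SubGaussianGrowth.heatAmplitude hτ.2 ha x
    rw [contDiffOn_infty]
    exact fun n => (hc.contDiffOn_integral a n).congr fun p hp =>
      Qfun_eq_integral hτ.2 ha x p.1 hp.2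
  · intro x y t ht
    have hc := SubGaussianGrowth.heatAmplitude hτ.2 ha x
    have htime : deriv (fun s : ℝ => Qfun N τ a y x s) t =
        ∫ φ, Complex.exp (heatExponent a φ (y, t)) •
          (heatExponent a φ (0, 1) * heatAmplitude τ a x φ) := by
      have h := hc.hasDerivAt_integral_comp a
        ((hasDerivAt_const t y).prodMk (hasDerivAt_id t)) ht
      refine (h.congr_of_eventuallyEq ?_).deriv
      filter_upwards [lt_mem_nhds ht] with s hs using Qfun_eq_integral hτ.2 ha x y hs
    have hγ : ∀ i u, HasDerivAt (fun v => (Function.update y i v, t))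
        ((Pi.single i 1 : Fin N → ℝ), (0 : ℝ)) u := fun i u =>
      (hasDerivAt_update y i u).prodMk (hasDerivAt_const u t)
    have hspace : ∀ i, deriv (fun u : ℝ =>
          deriv (fun v : ℝ => Qfun N τ a (Function.update y i v) x t) u) (y i) =
        ∫ φ, Complex.exp (heatExponent a φ (y, t)) •
          (heatExponent a φ (Pi.single i 1, 0) *
            (heatExponent a φ (Pi.single i 1, 0) * heatAmplitude τ a x φ)) := by
      intro i
      simp only [Qfun_eq_integral hτ.2 ha x _ ht,
        (hc.hasDerivAt_integral_comp a (hγ i _) ht).deriv]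
      have h := (((SubGaussianGrowth.heatExponent_apply a (Pi.single i 1, 0)).mul
        hc).hasDerivAt_integral_comp a (hγ i (y i)) ht).deriv
      simpa only [Function.update_eq_self] using h
    simp only [htime, hspace]
    rw [← integral_finsetSum, ← integral_const_mul]
    · congr 1 with φ
      have htime_coeff : heatExponent a φ (0, 1) =
          ∑ j, lineZ a (φ j) * lineZ a (φ j) * (1 / 2) := by
        simp [heatExponent_apply]
      have hspace_coeff : ∀ i, heatExponent a φ (Pi.single i 1, 0) = -lineZ a (φ i) := by
        intro i
        rw [heatExponent_apply, Finset.sum_eq_single i (fun j _ hj => by simp [hj]) (by simp)]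
        simp
      simp only [htime_coeff, hspace_coeff, smul_eq_mul, Finset.sum_mul, Finset.mul_sum]
      exact Finset.sum_congr rfl fun j _ => by ring
    · intro i _
      have hv := SubGaussianGrowth.heatExponent_apply a ((Pi.single i 1 : Fin N → ℝ), (0 : ℝ))
      exact (hv.mul (hv.mul hc)).integrable_exp_smul a (p := (y, t)) ht
end

section
/- For every t > 0, every x ∈ ℝ^N, every j ∈ {1,…,N−1}, and every y ∈ ℝ^N with y_j = y_{j+1}, the Bethe-ansatz function Q satisfies the boundary condition τ ∂Q_y(x,t)/∂y_j − ∂Q_y(x,t)/∂y_{j+1} = 0. -/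
open MeasureTheory Filter Set

/-- The integrand of the contour integral `Iperm`. -/
noncomputable def betheIntegrand (N : ℕ) (τ a : ℝ) (σ : Equiv.Perm (Fin N))
    (y x : Fin N → ℝ) (t : ℝ) (φ : Fin N → ℝ) : ℂ :=
  Aamp N τ σ (fun j => lineZ a (φ j)) *
    ∏ j : Fin N,
      Complex.exp (lineZ a (φ (σ j)) * ((x j : ℂ) - (y (σ j) : ℂ))) *
        Complex.exp (lineZ a (φ j) ^ 2 * (t : ℂ) / 2)

/-! ### Exchange relation for the amplitudes -/

lemma swap_lt_swap_iff {N : ℕ} {i k u v : Fin N} (hik : (k : ℕ) = i + 1)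
    (h₁ : ¬(u = i ∧ v = k)) (h₂ : ¬(u = k ∧ v = i)) :
    Equiv.swap i k u < Equiv.swap i k v ↔ u < v := by
  simp only [Equiv.swap_apply_def]
  split_ifs <;> simp only [Fin.lt_def, Fin.ext_iff] at * <;> omega

lemma Aamp_swap_mul_of_lt {N : ℕ} (τ : ℝ) {i k : Fin N} (hik : (k : ℕ) = i + 1)
    (σ : Equiv.Perm (Fin N)) (h : σ.symm i < σ.symm k) (z : Fin N → ℂ) :
    Aamp N τ (Equiv.swap i k * σ) (fun l => z (Equiv.swap i k l)) =
      Sfac τ (z i) (z k) * Aamp N τ σ z := by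
  have hlt : i < k := Fin.lt_def.2 (by omega)
  have hset : Finset.univ.filter (fun pr : Fin N × Fin N =>
        pr.1 < pr.2 ∧ (Equiv.swap i k * σ) pr.2 < (Equiv.swap i k * σ) pr.1) =
      insert (σ.symm i, σ.symm k) (Finset.univ.filter (fun pr : Fin N × Fin N =>
        pr.1 < pr.2 ∧ σ pr.2 < σ pr.1)) := by
    ext ⟨p, q⟩
    rw [Finset.mem_insert, Finset.mem_filter, Finset.mem_filter]
    simp only [Finset.mem_univ, true_and, Prod.mk.injEq, Equiv.Perm.mul_apply]
    by_cases h₁ : σ q = i ∧ σ p = k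
    · obtain ⟨rfl, rfl⟩ := h₁
      simp only [Equiv.symm_apply_apply] at h ⊢
      constructor
      · exact fun h' => absurd h'.1 h.asymm
      · rintro (⟨rfl, -⟩ | h')
        · exact absurd h (lt_irrefl _)
        · exact absurd h'.1 h.asymm
    by_cases h₂ : σ q = k ∧ σ p = i
    · obtain ⟨rfl, rfl⟩ := h₂
      simp only [Equiv.symm_apply_apply] at h ⊢
      simp [h, hlt]
    · rw [swap_lt_swap_iff hik h₁ h₂]
      have : ¬(p = σ.symm i ∧ q = σ.symm k) := by
        rintro ⟨rfl, rfl⟩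
        simp at h₂
      simp [this]
  rw [Aamp, hset, Finset.prod_insert, Aamp]
  · simp
  · simp [hlt.le]

lemma Aamp_swap_exchange {N : ℕ} (τ : ℝ) {i k : Fin N} (hik : (k : ℕ) = i + 1)
    (σ : Equiv.Perm (Fin N)) (z : Fin N → ℂ) (hz₁ : (τ : ℂ) * z k - z i ≠ 0)
    (hz₂ : (τ : ℂ) * z i - z k ≠ 0) :
    ((τ : ℂ) * z k - z i) * Aamp N τ (Equiv.swap i k * σ) (fun l => z (Equiv.swap i k l)) =
      -(((τ : ℂ) * z i - z k) * Aamp N τ σ z) := by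
  have hne : σ.symm i ≠ σ.symm k := fun h => by
    have := congrArg Fin.val (σ.symm.injective h)
    omega
  rcases hne.lt_or_gt with h | h
  · rw [Aamp_swap_mul_of_lt τ hik σ h, Sfac]
    field_simp
  · have key := Aamp_swap_mul_of_lt τ hik (Equiv.swap i k * σ)
      (by simpa [← Equiv.Perm.inv_def, mul_inv_rev] using h) (fun l => z (Equiv.swap i k l))
    simp only [← mul_assoc, Equiv.swap_mul_self, one_mul, Equiv.swap_apply_self,
      Equiv.swap_apply_left, Equiv.swap_apply_right] at key
    rw [key, Sfac]
    field_simp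

/-! ### Points of the contour -/

lemma re_lineZ (a φ : ℝ) : (lineZ a φ).re = a := by simp [lineZ]

lemma mul_lineZ_sub_lineZ_ne_zero {τ a : ℝ} (hτ : τ ∈ Set.Ioo (0 : ℝ) 1) (ha : 0 < a) (u v : ℝ) :
    (τ : ℂ) * lineZ a u - lineZ a v ≠ 0 := fun h => by
  have := congrArg Complex.re h
  simp [re_lineZ] at this
  nlinarith [hτ.2]

lemma norm_lineZ_le {a : ℝ} (ha : 0 < a) (u : ℝ) : ‖lineZ a u‖ ≤ (a + 1) * Real.exp |u| := by
  have h₁ : ‖lineZ a u‖ ≤ a + |u| := by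
    refine (norm_add_le _ _).trans ?_
    simp [abs_of_pos ha]
  nlinarith [Real.add_one_le_exp |u|, abs_nonneg u]

lemma norm_Sfac_lineZ_le {τ a : ℝ} (hτ : τ ∈ Set.Ioo (0 : ℝ) 1) (ha : 0 < a) (u v : ℝ) :
    ‖Sfac τ (lineZ a u) (lineZ a v)‖ ≤
      2 * (a + 1) / ((1 - τ) * a) * (Real.exp |u| * Real.exp |v|) := by
  have hpos : 0 < (1 - τ) * a := mul_pos (by linarith [hτ.2]) ha
  have hden : (1 - τ) * a ≤ ‖(τ : ℂ) * lineZ a v - lineZ a u‖ := by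
    refine le_trans ?_ (Complex.abs_re_le_norm _)
    simp only [Complex.sub_re, Complex.re_ofReal_mul, re_lineZ]
    refine le_trans ?_ (neg_le_abs _)
    linarith
  have hnum : ‖(τ : ℂ) * lineZ a u - lineZ a v‖ ≤
      2 * (a + 1) * (Real.exp |u| * Real.exp |v|) := by
    refine (norm_sub_le _ _).trans ?_
    rw [norm_mul, Complex.norm_real, Real.norm_of_nonneg hτ.1.le]
    have hu := norm_lineZ_le ha u
    have hv := norm_lineZ_le ha v
    have eu : 1 ≤ Real.exp |u| := Real.one_le_exp (abs_nonneg u)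
    have ev : 1 ≤ Real.exp |v| := Real.one_le_exp (abs_nonneg v)
    have h₁ : τ * ‖lineZ a u‖ ≤ ‖lineZ a u‖ := mul_le_of_le_one_left (norm_nonneg _) hτ.2.le
    have h₂ : Real.exp |u| ≤ Real.exp |u| * Real.exp |v| := le_mul_of_one_le_right (by positivity) ev
    have h₃ : Real.exp |v| ≤ Real.exp |u| * Real.exp |v| := le_mul_of_one_le_left (by positivity) eu
    have h₄ := mul_le_mul_of_nonneg_left h₂ (by linarith : 0 ≤ a + 1)
    have h₅ := mul_le_mul_of_nonneg_left h₃ (by linarith : 0 ≤ a + 1)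
    linarith
  rw [Sfac, norm_neg, norm_div, div_mul_eq_mul_div]
  gcongr

lemma exp_abs_le_prod {ι : Type*} [Fintype ι] (φ : ι → ℝ) (i : ι) :
    Real.exp |φ i| ≤ ∏ l, Real.exp |φ l| := by
  rw [← Real.exp_sum, Real.exp_le_exp]
  exact Finset.single_le_sum (f := fun l => |φ l|) (fun _ _ => abs_nonneg _) (Finset.mem_univ i)

lemma norm_Aamp_lineZ_le {N : ℕ} {τ a : ℝ} (hτ : τ ∈ Set.Ioo (0 : ℝ) 1) (ha : 0 < a)
    (σ : Equiv.Perm (Fin N)) :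
    ∃ C : ℝ, ∃ M : ℕ, ∀ φ : Fin N → ℝ,
      ‖Aamp N τ σ (fun l => lineZ a (φ l))‖ ≤ C * ∏ l, Real.exp |φ l| ^ M := by
  have hpos : 0 < (1 - τ) * a := mul_pos (by linarith [hτ.2]) ha
  set I := Finset.univ.filter (fun pr : Fin N × Fin N => pr.1 < pr.2 ∧ σ pr.2 < σ pr.1) with hI
  refine ⟨(2 * (a + 1) / ((1 - τ) * a)) ^ I.card, 2 * I.card, fun φ => ?_⟩
  rw [Aamp, norm_prod, Finset.prod_pow, pow_mul, ← mul_pow, pow_two, ← hI,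
    ← Finset.prod_const]
  refine Finset.prod_le_prod (fun _ _ => norm_nonneg _) fun pr _ =>
    (norm_Sfac_lineZ_le hτ ha _ _).trans ?_
  gcongr <;> exact exp_abs_le_prod φ _

/-! ### Integrability -/

lemma integrable_prod_exp_abs_pow_mul_exp_neg_sq {ι : Type*} [Fintype ι] {t : ℝ} (ht : 0 < t)
    (M : ℕ) :
    Integrable (fun φ : ι → ℝ => ∏ l, (Real.exp |φ l| ^ M * Real.exp (-(φ l ^ 2 * t / 2)))) := by
  refine Integrable.fintype_prod (f := fun _ u => Real.exp |u| ^ M * Real.exp (-(u ^ 2 * t / 2)))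
    fun _ => ?_
  refine ((integrable_exp_neg_mul_sq (by positivity : 0 < t / 4)).const_mul
    (Real.exp (M ^ 2 / t))).mono' (by fun_prop) (.of_forall fun u => ?_)
  rw [Real.norm_of_nonneg (by positivity), ← Real.exp_nat_mul, ← Real.exp_add, ← Real.exp_add,
    Real.exp_le_exp]
  have : (M : ℝ) ^ 2 / t + t / 4 * |u| ^ 2 - M * |u| = (M - t * |u| / 2) ^ 2 / t := by
    field_simp
    ring
  have h₂ : 0 ≤ ((M : ℝ) - t * |u| / 2) ^ 2 / t := by positivity
  rw [sq_abs] at this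
  nlinarith

lemma norm_prod_exp_lineZ {N : ℕ} (a : ℝ) (σ : Equiv.Perm (Fin N)) (y x : Fin N → ℝ) (t : ℝ)
    (φ : Fin N → ℝ) :
    ‖∏ l : Fin N, Complex.exp (lineZ a (φ (σ l)) * ((x l : ℂ) - (y (σ l) : ℂ))) *
        Complex.exp (lineZ a (φ l) ^ 2 * (t : ℂ) / 2)‖ =
      (∏ l, Real.exp (a * (x l - y (σ l)) + a ^ 2 * t / 2)) *
        ∏ l, Real.exp (-(φ l ^ 2 * t / 2)) := by
  rw [norm_prod, ← Finset.prod_mul_distrib]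
  refine Finset.prod_congr rfl fun l _ => ?_
  rw [norm_mul, Complex.norm_exp, Complex.norm_exp, ← Real.exp_add, ← Real.exp_add]
  congr 1
  simp [lineZ, pow_two]
  ring

lemma measurable_betheIntegrand (N : ℕ) (τ a : ℝ) (σ : Equiv.Perm (Fin N))
    (y x : Fin N → ℝ) (t : ℝ) : Measurable (betheIntegrand N τ a σ y x t) := by
  unfold betheIntegrand Aamp Sfac lineZ
  fun_prop

lemma norm_betheIntegrand_le {N : ℕ} {τ a : ℝ} (hτ : τ ∈ Set.Ioo (0 : ℝ) 1) (ha : 0 < a)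
    (σ : Equiv.Perm (Fin N)) (y x : Fin N → ℝ) (t : ℝ) :
    ∃ C : ℝ, ∃ M : ℕ, ∀ φ : Fin N → ℝ, ‖betheIntegrand N τ a σ y x t φ‖ ≤
      C * ∏ l, (Real.exp |φ l| ^ M * Real.exp (-(φ l ^ 2 * t / 2))) := by
  obtain ⟨C, M, hCM⟩ := norm_Aamp_lineZ_le hτ ha σ
  refine ⟨C * ∏ l, Real.exp (a * (x l - y (σ l)) + a ^ 2 * t / 2), M, fun φ => ?_⟩
  rw [betheIntegrand, norm_mul, norm_prod_exp_lineZ, Finset.prod_mul_distrib, mul_mul_mul_comm]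
  exact mul_le_mul_of_nonneg_right (hCM φ) (by positivity)

lemma integrable_betheIntegrand {N : ℕ} {τ a t : ℝ} (hτ : τ ∈ Set.Ioo (0 : ℝ) 1) (ha : 0 < a)
    (ht : 0 < t) (σ : Equiv.Perm (Fin N)) (y x : Fin N → ℝ) :
    Integrable (betheIntegrand N τ a σ y x t) := by
  obtain ⟨C, M, h⟩ := norm_betheIntegrand_le hτ ha σ y x t
  exact ((integrable_prod_exp_abs_pow_mul_exp_neg_sq ht M).const_mul C).mono'
    (measurable_betheIntegrand ..).aestronglyMeasurable (.of_forall h)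

lemma integrable_lineZ_mul_betheIntegrand {N : ℕ} {τ a t : ℝ} (hτ : τ ∈ Set.Ioo (0 : ℝ) 1)
    (ha : 0 < a) (ht : 0 < t) (σ : Equiv.Perm (Fin N)) (y x : Fin N → ℝ) (i : Fin N) :
    Integrable (fun φ => lineZ a (φ i) * betheIntegrand N τ a σ y x t φ) := by
  obtain ⟨C, M, h⟩ := norm_betheIntegrand_le hτ ha σ y x t
  refine ((integrable_prod_exp_abs_pow_mul_exp_neg_sq ht (M + 1)).const_mul ((a + 1) * C)).mono'
    (Measurable.aestronglyMeasurable ?_) (.of_forall fun φ => ?_)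
  · have := measurable_betheIntegrand N τ a σ y x t
    unfold lineZ
    fun_prop
  have hle := exp_abs_le_prod φ i
  calc ‖lineZ a (φ i) * betheIntegrand N τ a σ y x t φ‖
      ≤ ((a + 1) * ∏ m, Real.exp |φ m|) *
          (C * ∏ l, (Real.exp |φ l| ^ M * Real.exp (-(φ l ^ 2 * t / 2)))) := by
        rw [norm_mul]
        refine mul_le_mul ((norm_lineZ_le ha _).trans ?_) (h φ) (norm_nonneg _) (by positivity)
        gcongr
    _ = _ := by
        simp only [pow_succ, Finset.prod_mul_distrib]
        ring

/-! ### Differentiation in the initial configuration -/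

lemma betheIntegrand_update {N : ℕ} (τ a : ℝ) (σ : Equiv.Perm (Fin N))
    (y x : Fin N → ℝ) (t : ℝ) (i : Fin N) (v : ℝ) (φ : Fin N → ℝ) :
    betheIntegrand N τ a σ (Function.update y i v) x t φ =
      Complex.exp (-(lineZ a (φ i) * ((v : ℂ) - y i))) * betheIntegrand N τ a σ y x t φ := by
  have hone : Complex.exp (-(lineZ a (φ i) * ((v : ℂ) - y i))) =
      ∏ l, if σ l = i then Complex.exp (-(lineZ a (φ i) * ((v : ℂ) - y i))) else 1 := by
    rw [Equiv.prod_comp σ (fun m => if m = i then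
      Complex.exp (-(lineZ a (φ i) * ((v : ℂ) - y i))) else 1)]
    simp
  rw [betheIntegrand, betheIntegrand, mul_left_comm, hone, ← Finset.prod_mul_distrib]
  congr 1
  refine Finset.prod_congr rfl fun l _ => ?_
  split_ifs with h
  · rw [h, Function.update_self, ← mul_assoc,
      ← Complex.exp_add (-(lineZ a (φ i) * ((v : ℂ) - y i)))]
    congr 2
    ring_nf
  · rw [Function.update_of_ne h, one_mul]

lemma hasDerivAt_Iperm {N : ℕ} {τ a t : ℝ} (hτ : τ ∈ Set.Ioo (0 : ℝ) 1) (ha : 0 < a)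
    (ht : 0 < t) (σ : Equiv.Perm (Fin N)) (y x : Fin N → ℝ) (i : Fin N) :
    HasDerivAt (fun v : ℝ => Iperm N τ a σ (Function.update y i v) x t)
      ((1 / (2 * Real.pi)) ^ N *
        ∫ φ, -(lineZ a (φ i) * betheIntegrand N τ a σ y x t φ)) (y i) := by
  refine HasDerivAt.const_mul _ ?_
  have hF := integrable_lineZ_mul_betheIntegrand hτ ha ht σ y x i
  have hmain := hasDerivAt_integral_of_dominated_loc_of_deriv_le (μ := volume)
    (F := fun v φ => betheIntegrand N τ a σ (Function.update y i v) x t φ)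
    (F' := fun v φ => -lineZ a (φ i) * betheIntegrand N τ a σ (Function.update y i v) x t φ)
    (x₀ := y i) (bound := fun φ => Real.exp a * ‖lineZ a (φ i) * betheIntegrand N τ a σ y x t φ‖)
    (Metric.ball_mem_nhds (y i) one_pos)
    (.of_forall fun v => (measurable_betheIntegrand ..).aestronglyMeasurable)
    (integrable_betheIntegrand hτ ha ht ..)
    (by
      simp only [neg_mul]
      exact (integrable_lineZ_mul_betheIntegrand hτ ha ht σ _ x i).aestronglyMeasurable.neg)
    (.of_forall fun φ v hv => ?_) (hF.norm.const_mul _) (.of_forall fun φ v _ => ?_)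
  · simp only [Function.update_eq_self, neg_mul] at hmain
    exact hmain.2
  · rw [betheIntegrand_update, mul_left_comm, norm_mul, neg_mul, norm_neg, Complex.norm_exp]
    gcongr
    rw [Metric.mem_ball, Real.dist_eq] at hv
    simp only [Complex.neg_re, ← Complex.ofReal_sub, Complex.re_mul_ofReal, re_lineZ]
    nlinarith [neg_abs_le (v - y i)]
  · simp only [betheIntegrand_update τ a σ y x t i]
    have h₁ : HasDerivAt (fun v : ℝ => -(lineZ a (φ i) * ((v : ℂ) - y i))) (-lineZ a (φ i)) v :=
      ((((hasDerivAt_id v).ofReal_comp).sub_const (y i : ℂ)).const_mul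
        (lineZ a (φ i))).fun_neg.congr_deriv (by simp)
    exact (h₁.cexp.mul_const (betheIntegrand N τ a σ y x t φ)).congr_deriv (by ring)

/-! ### Cancellation -/

lemma betheIntegrand_swap_exchange {N : ℕ} {τ a : ℝ} (hτ : τ ∈ Set.Ioo (0 : ℝ) 1) (ha : 0 < a)
    {i k : Fin N} (hik : (k : ℕ) = i + 1) (σ : Equiv.Perm (Fin N)) (y x : Fin N → ℝ)
    (hy : y i = y k) (t : ℝ) (φ : Fin N → ℝ) :
    ((τ : ℂ) * lineZ a (φ k) - lineZ a (φ i)) *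
        betheIntegrand N τ a (Equiv.swap i k * σ) y x t (fun l => φ (Equiv.swap i k l)) =
      -(((τ : ℂ) * lineZ a (φ i) - lineZ a (φ k)) * betheIntegrand N τ a σ y x t φ) := by
  have hys (l : Fin N) : y (Equiv.swap i k l) = y l := by
    rw [Equiv.swap_apply_def]
    split_ifs with h₁ h₂
    · rw [h₁, hy]
    · rw [h₂, hy]
    · rfl
  have hA := Aamp_swap_exchange τ hik σ (fun l => lineZ a (φ l))
    (mul_lineZ_sub_lineZ_ne_zero hτ ha _ _) (mul_lineZ_sub_lineZ_ne_zero hτ ha _ _)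
  rw [betheIntegrand, betheIntegrand, ← mul_assoc, hA, neg_mul, mul_assoc]
  simp only [Finset.prod_mul_distrib, Equiv.Perm.mul_apply, Equiv.swap_apply_self, hys]
  rw [Equiv.prod_comp (Equiv.swap i k)
    (fun l => Complex.exp (lineZ a (φ l) ^ 2 * (t : ℂ) / 2))]

lemma integral_comp_perm {ι : Type*} [Fintype ι] (s : Equiv.Perm ι) (f : (ι → ℝ) → ℂ) :
    ∫ φ : ι → ℝ, f (fun l => φ (s l)) = ∫ φ, f φ :=
  (volume_measurePreserving_piCongrLeft (fun _ : ι => ℝ) s).symm.integral_comp' (g := f)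

lemma sum_integral_eq_zero {N : ℕ} {τ a : ℝ} (hτ : τ ∈ Set.Ioo (0 : ℝ) 1) (ha : 0 < a)
    {i k : Fin N} (hik : (k : ℕ) = i + 1) (y x : Fin N → ℝ) (hy : y i = y k) (t : ℝ) :
    ∑ σ : Equiv.Perm (Fin N), ∫ φ : Fin N → ℝ,
      ((τ : ℂ) * lineZ a (φ i) - lineZ a (φ k)) * betheIntegrand N τ a σ y x t φ = 0 := by
  refine CharZero.eq_neg_self_iff.mp ?_
  conv_lhs => rw [← Equiv.sum_comp (Equiv.mulLeft (Equiv.swap i k))]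
  rw [← Finset.sum_neg_distrib]
  refine Finset.sum_congr rfl fun σ _ => ?_
  rw [← integral_neg, ← integral_comp_perm (Equiv.swap i k)]
  refine integral_congr_ae (.of_forall fun φ => ?_)
  simp only [Equiv.coe_mulLeft, Equiv.swap_apply_left, Equiv.swap_apply_right]
  exact betheIntegrand_swap_exchange hτ ha hik σ y x hy t φ

lemma hasDerivAt_Qfun {N : ℕ} {τ a t : ℝ} (hτ : τ ∈ Set.Ioo (0 : ℝ) 1) (ha : 0 < a)
    (ht : 0 < t) (y x : Fin N → ℝ) (i : Fin N) :
    HasDerivAt (fun v : ℝ => Qfun N τ a (Function.update y i v) x t)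
      (∑ σ : Equiv.Perm (Fin N), (1 / (2 * Real.pi)) ^ N *
        ∫ φ, -(lineZ a (φ i) * betheIntegrand N τ a σ y x t φ)) (y i) :=
  HasDerivAt.fun_sum fun σ _ => hasDerivAt_Iperm hτ ha ht σ y x i

/-- Boundary condition for the Bethe-ansatz function: for `y_j = y_{j+1}`,
`τ ∂Q_y(x,t)/∂y_j − ∂Q_y(x,t)/∂y_{j+1} = 0`. -/
theorem Qfun_boundary (N : ℕ) (hN : 1 ≤ N) (τ : ℝ) (hτ : τ ∈ Set.Ioo (0 : ℝ) 1)
    (a : ℝ) (ha : 0 < a) (t : ℝ) (ht : 0 < t) (x : Fin N → ℝ)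
    (j : Fin N) (hj : (j : ℕ) + 1 < N)
    (y : Fin N → ℝ) (hy : y j = y ⟨(j : ℕ) + 1, hj⟩) :
    (τ : ℂ) * deriv (fun v : ℝ => Qfun N τ a (Function.update y j v) x t) (y j) -
      deriv (fun v : ℝ => Qfun N τ a (Function.update y ⟨(j : ℕ) + 1, hj⟩ v) x t)
        (y ⟨(j : ℕ) + 1, hj⟩) = 0 := by
  rw [(hasDerivAt_Qfun hτ ha ht y x j).deriv, (hasDerivAt_Qfun hτ ha ht y x _).deriv,
    Finset.mul_sum, ← Finset.sum_sub_distrib]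
  have h := sum_integral_eq_zero hτ ha (i := j) (k := ⟨(j : ℕ) + 1, hj⟩) rfl y x hy t
  rw [← mul_zero (-(1 / (2 * (Real.pi : ℂ))) ^ N), ← h, Finset.mul_sum]
  refine Finset.sum_congr rfl fun σ _ => ?_
  simp only [sub_mul, mul_assoc]
  rw [integral_sub ((integrable_lineZ_mul_betheIntegrand hτ ha ht σ y x _).const_mul _)
    (integrable_lineZ_mul_betheIntegrand hτ ha ht σ y x _), integral_const_mul, integral_neg,
    integral_neg]
  ring
end
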